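/- arXiv:2502.11148 — 9 statements merged into one kernel-verified Lean document; each statement's English description precedes it below -/
import Mathlib

section
/- Let A be a finite type, let f be a nonnegative subadditive set function on finite subsets of A (i.e., f(X ∪ Y) ≤ f(X) + f(Y) for all finite X, Y ⊆ A), let S be a finite subset of A, and let k be a positive integer such that f(S) ≥ k · f({i}) for every i ∈ S. Suppose S is divided uniformly at random into two groups T₁ and T₂, i.e., each element of S is placed independently with probability 1/2 into T₁ and otherwise into T₂. Then with probability at least 1/2, both f(T₁) ≥ ((k−1)/(4k)) · f(S) and f(T₂) ≥ ((k−1)/(4k)) · f(S). -/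
open scoped Classical

/-- A nonnegative subadditive function `g` all of whose singletons in `S` are small admits a
split of `S` into two parts of nearly half the value each. -/
lemma exists_balanced_split {A : Type*} [DecidableEq A]
    (g : Finset A → ℝ) (hg0 : ∀ X, 0 ≤ g X)
    (hsub : ∀ X Y, g (X ∪ Y) ≤ g X + g Y)
    (S : Finset A) (k : ℕ) (hk : 0 < k)
    (hki : ∀ i ∈ S, (k : ℝ) * g {i} ≤ g S) :
    ∃ X ⊆ S, ((k : ℝ) - 1) / (2 * k) * g S ≤ g X ∧
      ((k : ℝ) - 1) / (2 * k) * g S ≤ g (S \ X) := by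
  have hk' : (0 : ℝ) < k := by exact_mod_cast hk
  set c := ((k : ℝ) - 1) / (2 * k) * g S with hc
  have hcS : c ≤ g S := by
    refine mul_le_of_le_one_left (hg0 S) ?_
    rw [div_le_one (by positivity)]
    linarith
  obtain ⟨X, hX, hmin⟩ := (S.powerset.filter fun X => c ≤ g X).exists_min_image Finset.card
    ⟨S, by simp [hcS]⟩
  simp only [Finset.mem_filter, Finset.mem_powerset] at hX hmin
  refine ⟨X, hX.1, hX.2, ?_⟩
  obtain rfl | ⟨i, hi⟩ := X.eq_empty_or_nonempty
  · simpa using hcS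
  · have herase : g (X.erase i) < c := by
      by_contra! h
      have hle := hmin _ ⟨(Finset.erase_subset _ _).trans hX.1, h⟩
      exact (Finset.card_erase_lt_of_mem hi).not_ge hle
    have hXi := hsub {i} (X.erase i)
    rw [← Finset.insert_eq, Finset.insert_erase hi] at hXi
    have hSX := hsub X (S \ X)
    rw [Finset.union_sdiff_of_subset hX.1] at hSX
    have hsingle : g {i} ≤ g S / k := by
      rw [le_div_iff₀ hk', mul_comm]
      exact hki i (hX.1 hi)
    have hsum : 2 * c + g S / k = g S := by
      rw [hc]
      field_simp
      ring
    linarith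

/-- The largest monotone minorant, on the subsets of `S`, of a function of finite sets. -/
noncomputable def monotoneMinorant {A : Type*} [Fintype A] [DecidableEq A]
    (f : Finset A → ℝ) (S X : Finset A) : ℝ :=
  Finset.univ.inf' Finset.univ_nonempty fun Z => f ((X ∪ Z) ∩ S)

section monotoneMinorant

variable {A : Type*} [Fintype A] [DecidableEq A] (f : Finset A → ℝ) (S : Finset A)

lemma monotoneMinorant_le_apply (X Z : Finset A) :
    monotoneMinorant f S X ≤ f ((X ∪ Z) ∩ S) :=
  Finset.inf'_le _ (Finset.mem_univ Z)

lemma exists_monotoneMinorant_eq (X : Finset A) :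
    ∃ Z, monotoneMinorant f S X = f ((X ∪ Z) ∩ S) := by
  obtain ⟨Z, -, hZ⟩ := Finset.exists_mem_eq_inf' (Finset.univ_nonempty (α := Finset A))
    fun Z => f ((X ∪ Z) ∩ S)
  exact ⟨Z, hZ⟩

lemma monotoneMinorant_le {X : Finset A} (hX : X ⊆ S) : monotoneMinorant f S X ≤ f X := by
  simpa [Finset.inter_eq_left.mpr hX] using monotoneMinorant_le_apply f S X ∅

lemma monotoneMinorant_self : monotoneMinorant f S S = f S := by
  obtain ⟨Z, hZ⟩ := exists_monotoneMinorant_eq f S S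
  rw [hZ, Finset.inter_eq_right.mpr Finset.subset_union_left]

lemma monotone_monotoneMinorant : Monotone (monotoneMinorant f S) := by
  intro X Y hXY
  obtain ⟨Z, hZ⟩ := exists_monotoneMinorant_eq f S Y
  have h := monotoneMinorant_le_apply f S X (Y ∪ Z)
  rwa [← Finset.union_assoc, Finset.union_eq_right.mpr hXY, ← hZ] at h

lemma monotoneMinorant_nonneg (hf0 : ∀ X, 0 ≤ f X) (X : Finset A) :
    0 ≤ monotoneMinorant f S X := by
  obtain ⟨Z, hZ⟩ := exists_monotoneMinorant_eq f S X
  exact hZ ▸ hf0 _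

lemma monotoneMinorant_union_le (hsub : ∀ X Y, f (X ∪ Y) ≤ f X + f Y) (X Y : Finset A) :
    monotoneMinorant f S (X ∪ Y) ≤ monotoneMinorant f S X + monotoneMinorant f S Y := by
  obtain ⟨Z, hZ⟩ := exists_monotoneMinorant_eq f S X
  obtain ⟨W, hW⟩ := exists_monotoneMinorant_eq f S Y
  have h := monotoneMinorant_le_apply f S (X ∪ Y) (Z ∪ W)
  rw [Finset.union_union_union_comm, Finset.union_inter_distrib_right] at h
  rw [hZ, hW]
  exact h.trans (hsub _ _)

end monotoneMinorant

/-- If an involution sends every point outside `p` into `p`, then `p` has density at least half. -/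
lemma half_le_card_filter_div_card {α : Type*} [Fintype α] [Nonempty α] (p : α → Prop)
    [DecidablePred p] (e : α → α) (he : Function.Involutive e) (hp : ∀ a, p a ∨ p (e a)) :
    (1 : ℝ) / 2 ≤ ((Finset.univ.filter p).card : ℝ) / Fintype.card α := by
  have hle : (Finset.univ.filter fun a => ¬ p a).card ≤ (Finset.univ.filter p).card :=
    Finset.card_le_card_of_injOn e
      (fun a ha => by
        have ha' : ¬ p a := by simpa using ha
        simpa using (hp a).resolve_left ha')
      he.injective.injOn
  have hadd := Finset.card_filter_add_card_filter_not (s := (Finset.univ : Finset α)) p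
  rw [Finset.card_univ] at hadd
  have hpos : (0 : ℝ) < Fintype.card α := by exact_mod_cast Fintype.card_pos
  have htwo : (Fintype.card α : ℝ) ≤ 2 * (Finset.univ.filter p).card := by
    exact_mod_cast (by omega : Fintype.card α ≤ 2 * (Finset.univ.filter p).card)
  rw [div_le_div_iff₀ two_pos hpos]
  linarith

/-- Lemma 2.1 of Bei et al.: for a nonnegative subadditive set function `f` and a finite
set `S` with `f S ≥ k · f {i}` for every `i ∈ S`, if each element of `S` is independently
placed with probability `1/2` into `T₁ = {i ∈ S : σ i = true}` and otherwise into
`T₂ = S \ T₁`, then with probability at least `1/2` both parts have `f`-value at least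
`((k-1)/(4k)) · f S`. -/
theorem subadditive_balanced_sampling {A : Type*} [Fintype A] [DecidableEq A]
    (f : Finset A → ℝ) (hf0 : ∀ X, 0 ≤ f X)
    (hsub : ∀ X Y, f (X ∪ Y) ≤ f X + f Y)
    (S : Finset A) (k : ℕ) (hk : 0 < k)
    (hki : ∀ i ∈ S, (k : ℝ) * f {i} ≤ f S) :
    (1 : ℝ) / 2 ≤
      ((Finset.univ.filter fun σ : A → Bool =>
          ((k : ℝ) - 1) / (4 * k) * f S ≤ f (S.filter fun i => σ i = true) ∧
          ((k : ℝ) - 1) / (4 * k) * f S ≤ f (S \ S.filter fun i => σ i = true)).card : ℝ) /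
        (Fintype.card (A → Bool)) := by
  set g := monotoneMinorant f S with hg
  have hgsub := monotoneMinorant_union_le f S hsub
  have hmono : Monotone g := monotone_monotoneMinorant f S
  have hgS : g S = f S := monotoneMinorant_self f S
  obtain ⟨X, hXS, hX, hY⟩ := exists_balanced_split g (monotoneMinorant_nonneg f S hf0) hgsub
    S k hk fun i hi => by
      rw [hgS]
      refine le_trans ?_ (hki i hi)
      gcongr
      exact monotoneMinorant_le f S (Finset.singleton_subset_iff.mpr hi)
  rw [hgS] at hX hY
  set c := ((k : ℝ) - 1) / (4 * k) * f S with hc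
  have hc2 : ((k : ℝ) - 1) / (2 * k) * f S = 2 * c := by
    rw [hc]
    field_simp
    ring
  rw [hc2] at hX hY
  have hhalf : ∀ (W : Finset A) (σ : A → Bool), 2 * c ≤ g W →
      c ≤ g (W.filter fun i => σ i = true) ∨ c ≤ g (W.filter fun i => ¬ σ i = true) := by
    intro W σ hW
    by_contra! h
    have h' := hgsub (W.filter fun i => σ i = true) (W.filter fun i => ¬ σ i = true)
    rw [Finset.filter_union_filter_not_eq] at h'
    linarith [h.1, h.2]
  have hle : ∀ W V : Finset A, W ⊆ V → V ⊆ S → c ≤ g W → c ≤ f V := fun W V hWV hVS h =>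
    (h.trans (hmono hWV)).trans (monotoneMinorant_le f S hVS)
  refine half_le_card_filter_div_card _ (fun σ i => if i ∈ X then !σ i else σ i) ?_ ?_
  · intro σ
    funext i
    by_cases hi : i ∈ X <;> simp [hi]
  · intro σ
    rcases hhalf X σ hX with h₁ | h₁ <;> rcases hhalf (S \ X) σ hY with h₂ | h₂
    · right
      exact ⟨hle _ _ (by grind) (by grind) h₂, hle _ _ (by grind) (by grind) h₁⟩
    · left
      exact ⟨hle _ _ (by grind) (by grind) h₁, hle _ _ (by grind) (by grind) h₂⟩
    · left
      exact ⟨hle _ _ (by grind) (by grind) h₂, hle _ _ (by grind) (by grind) h₁⟩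
    · right
      exact ⟨hle _ _ (by grind) (by grind) h₁, hle _ _ (by grind) (by grind) h₂⟩
end

section
/- Consider a multi-unit auction with m identical items and a finite set N of bidders in which no bidder is critical, i.e., OPT({i}) ≤ OPT/100 for every bidder i, where OPT = OPT(N). Suppose each bidder is placed independently with probability 1/2 into a sampled set S and with the remaining probability into an unsampled set U = N \ S. Then with probability at least 1/2, both OPT(S) ≥ OPT/5 and OPT(U) ≥ OPT/5. -/
open scoped Classical

/-- Optimal welfare in a multi-unit auction with `m` identical items: the supremum of
`∑ i ∈ T, v i (q i)` over all allocations `q` with `∑ i ∈ T, q i ≤ m`. -/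
noncomputable def muaOPT {N : Type*} (m : ℕ) (v : N → ℕ → ℝ) (T : Finset N) : ℝ :=
  sSup {w : ℝ | ∃ q : N → ℕ, (∑ i ∈ T, q i) ≤ m ∧ w = ∑ i ∈ T, v i (q i)}

section Welfare

variable {N : Type*} {m : ℕ} {v : N → ℕ → ℝ} {T : Finset N}

theorem finite_setOf_welfare (m : ℕ) (v : N → ℕ → ℝ) (T : Finset N) :
    {w : ℝ | ∃ q : N → ℕ, (∑ i ∈ T, q i) ≤ m ∧ w = ∑ i ∈ T, v i (q i)}.Finite := by
  refine (Set.finite_range fun f : T → Fin (m + 1) ↦ ∑ i : T, v i (f i)).subset ?_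
  rintro w ⟨q, hq, rfl⟩
  refine ⟨fun i ↦ ⟨q i, Nat.lt_succ_of_le
    ((Finset.single_le_sum (fun j _ ↦ Nat.zero_le (q j)) i.2).trans hq)⟩, ?_⟩
  exact Finset.sum_coe_sort T fun i ↦ v i (q i)

theorem welfare_le_muaOPT (q : N → ℕ) (hq : ∑ i ∈ T, q i ≤ m) :
    ∑ i ∈ T, v i (q i) ≤ muaOPT m v T :=
  le_csSup (finite_setOf_welfare m v T).bddAbove ⟨q, hq, rfl⟩

theorem exists_welfare_eq_muaOPT (m : ℕ) (v : N → ℕ → ℝ) (T : Finset N) :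
    ∃ q : N → ℕ, ∑ i ∈ T, q i ≤ m ∧ muaOPT m v T = ∑ i ∈ T, v i (q i) :=
  have hne : {w : ℝ | ∃ q : N → ℕ, (∑ i ∈ T, q i) ≤ m ∧ w = ∑ i ∈ T, v i (q i)}.Nonempty :=
    ⟨_, fun _ ↦ 0, by simp, rfl⟩
  hne.csSup_mem (finite_setOf_welfare m v T)

end Welfare

section RandomSigns

variable {N : Type*} [Fintype N] [DecidableEq N]

/-- The sign `1` for `true` and `-1` for `false`. -/
def boolSign (b : Bool) : ℝ := if b then 1 else -1

theorem boolSign_not (b : Bool) : boolSign (!b) = -boolSign b := by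
  cases b <;> simp [boolSign]

theorem boolSign_mul_self (b : Bool) : boolSign b * boolSign b = 1 := by
  cases b <;> simp [boolSign]

theorem sum_boolSign_mul_boolSign_of_ne {i j : N} (hij : i ≠ j) :
    ∑ σ : N → Bool, boolSign (σ i) * boolSign (σ j) = 0 := by
  have hinv : Function.Involutive fun σ : N → Bool ↦ Function.update σ i (!σ i) := by
    intro σ
    simp
  have h := Equiv.sum_comp hinv.toPerm fun σ : N → Bool ↦ boolSign (σ i) * boolSign (σ j)
  simp only [Function.Involutive.coe_toPerm, Function.update_self,
    Function.update_of_ne hij.symm, boolSign_not, neg_mul, Finset.sum_neg_distrib] at h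
  linarith

theorem sum_sq_signed_sum (x : N → ℝ) :
    ∑ σ : N → Bool, (∑ i, x i * boolSign (σ i)) ^ 2 =
      Fintype.card (N → Bool) * ∑ i, x i ^ 2 := by
  have h (i j : N) : ∑ σ : N → Bool, x i * boolSign (σ i) * (x j * boolSign (σ j)) =
      if i = j then Fintype.card (N → Bool) * x i ^ 2 else 0 := by
    simp only [mul_mul_mul_comm (x i), ← Finset.mul_sum]
    split_ifs with hij
    · subst hij
      simp only [boolSign_mul_self, Finset.sum_const, Finset.card_univ, nsmul_eq_mul]
      ring
    · rw [sum_boolSign_mul_boolSign_of_ne hij, mul_zero]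
  simp only [sq (∑ i, _), Finset.sum_mul_sum]
  rw [Finset.sum_comm]
  simp_rw [Finset.sum_comm (s := (Finset.univ : Finset (N → Bool))), h]
  simp [Finset.mul_sum]

/-- Chebyshev's inequality for a weighted sum of independent uniform signs. -/
theorem card_mul_sq_le_of_le_abs_signed_sum (x : N → ℝ) {c : ℝ} (hc : 0 ≤ c)
    (B : Finset (N → Bool)) (hB : ∀ σ ∈ B, c ≤ |∑ i, x i * boolSign (σ i)|) :
    B.card * c ^ 2 ≤ Fintype.card (N → Bool) * ∑ i, x i ^ 2 := by
  rw [← sum_sq_signed_sum, ← nsmul_eq_mul]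
  refine (Finset.card_nsmul_le_sum B _ _ fun σ hσ ↦ ?_).trans
    (Finset.sum_le_univ_sum_of_nonneg fun σ ↦ sq_nonneg (∑ i, x i * boolSign (σ i)))
  rw [← sq_abs (∑ i, _)]
  exact pow_le_pow_left₀ hc (hB σ hσ) 2

end RandomSigns

/-- If no bidder is critical (`OPT({i}) ≤ OPT/100` for every `i`), then when every bidder
is independently placed with probability `1/2` into the sampled set
`S = {i : σ i = true}` and otherwise into `U = N \ S`, with probability at least `1/2`
both `OPT(S) ≥ OPT/5` and `OPT(U) ≥ OPT/5`. -/
theorem auction_sampling {N : Type*} [Fintype N] [DecidableEq N] (m : ℕ)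
    (v : N → ℕ → ℝ) (h0 : ∀ i, v i 0 = 0) (hnn : ∀ i q, 0 ≤ v i q)
    (hcrit : ∀ i : N, muaOPT m v {i} ≤ muaOPT m v Finset.univ / 100) :
    (1 : ℝ) / 2 ≤
      ((Finset.univ.filter fun σ : N → Bool =>
          muaOPT m v Finset.univ / 5 ≤
            muaOPT m v (Finset.univ.filter fun i => σ i = true) ∧
          muaOPT m v Finset.univ / 5 ≤
            muaOPT m v (Finset.univ \ Finset.univ.filter fun i => σ i = true)).card : ℝ) /
        (Fintype.card (N → Bool)) := by
  obtain ⟨q, hq, hopt⟩ := exists_welfare_eq_muaOPT m v Finset.univ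
  set O := muaOPT m v Finset.univ
  set x : N → ℝ := fun i ↦ v i (q i)
  have hx0 (i : N) : 0 ≤ x i := hnn i (q i)
  have hsub (T : Finset N) : ∑ i ∈ T, x i ≤ muaOPT m v T :=
    welfare_le_muaOPT q ((Finset.sum_le_univ_sum_of_nonneg fun i ↦ Nat.zero_le (q i)).trans hq)
  have hxO (i : N) : x i ≤ O / 100 := by
    simpa using (hsub {i}).trans (hcrit i)
  have hO0 : 0 ≤ O := hopt ▸ Finset.sum_nonneg fun i _ ↦ hx0 i
  have hsq : ∑ i, x i ^ 2 ≤ O ^ 2 / 100 :=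
    calc ∑ i, x i ^ 2 ≤ ∑ i, O / 100 * x i := Finset.sum_le_sum fun i _ ↦ by
          rw [sq]
          exact mul_le_mul_of_nonneg_right (hxO i) (hx0 i)
      _ = O ^ 2 / 100 := by
          rw [← Finset.mul_sum, ← hopt]
          ring
  have hcard : (0 : ℝ) < Fintype.card (N → Bool) := by exact_mod_cast Fintype.card_pos
  rw [le_div_iff₀ hcard]
  set P : (N → Bool) → Prop := fun σ ↦
    O / 5 ≤ muaOPT m v (Finset.univ.filter fun i ↦ σ i = true) ∧
      O / 5 ≤ muaOPT m v (Finset.univ \ Finset.univ.filter fun i ↦ σ i = true)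
  have hbad (σ : N → Bool) (hσ : ¬ P σ) : 3 / 5 * O ≤ |∑ i, x i * boolSign (σ i)| := by
    set S : Finset N := Finset.univ.filter fun i ↦ σ i = true
    have hsum : ∑ i ∈ Finset.univ \ S, x i + ∑ i ∈ S, x i = O :=
      (Finset.sum_sdiff (Finset.subset_univ S)).trans hopt.symm
    have hdiff : ∑ i, x i * boolSign (σ i) = ∑ i ∈ S, x i - ∑ i ∈ Finset.univ \ S, x i := by
      rw [← Finset.sum_sdiff (Finset.subset_univ S), sub_eq_neg_add, ← Finset.sum_neg_distrib]
      congr 1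
      · refine Finset.sum_congr rfl fun i hi ↦ ?_
        have hi' : σ i = false := by simpa [S] using hi
        simp [boolSign, hi']
      · refine Finset.sum_congr rfl fun i hi ↦ ?_
        have hi' : σ i = true := by simpa [S] using hi
        simp [boolSign, hi']
    rw [hdiff, le_abs]
    by_contra! h
    exact hσ ⟨by linarith [hsub S], by linarith [hsub (Finset.univ \ S)]⟩
  have hsplit := Finset.card_filter_add_card_filter_not (s := Finset.univ) P
  rw [Finset.card_univ] at hsplit
  have hsplit' : ((Finset.univ.filter P).card : ℝ) + (Finset.univ.filter fun σ ↦ ¬ P σ).card =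
      Fintype.card (N → Bool) := by exact_mod_cast hsplit
  rcases hO0.eq_or_lt with hzero | hpos
  · have hall (σ : N → Bool) : P σ := by
      have hnonneg (T : Finset N) : O / 5 ≤ muaOPT m v T := by
        rw [← hzero, zero_div]
        exact (Finset.sum_nonneg fun i _ ↦ hx0 i).trans (hsub T)
      exact ⟨hnonneg _, hnonneg _⟩
    have hempty : (Finset.univ.filter fun σ ↦ ¬ P σ).card = 0 := by simp [hall]
    rw [hempty] at hsplit'
    push_cast at hsplit'
    linarith
  · have hcheb := card_mul_sq_le_of_le_abs_signed_sum x (by positivity : 0 ≤ 3 / 5 * O)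
      (Finset.univ.filter fun σ ↦ ¬ P σ) fun σ hσ ↦ hbad σ (Finset.mem_filter.1 hσ).2
    have hmul := hcheb.trans (mul_le_mul_of_nonneg_left hsq hcard.le)
    have hle : ((Finset.univ.filter fun σ ↦ ¬ P σ).card : ℝ) * 36 ≤
        Fintype.card (N → Bool) := by
      refine le_of_mul_le_mul_right ?_ (by positivity : 0 < O ^ 2 / 100)
      linarith
    linarith
end

section
/- Consider a multi-unit auction with m ≥ 1 identical items and finitely many single-minded bidders, bidder i having demand d_i ∈ {1,...,m} and value x_i ≥ 0. For a bundle size ℓ ∈ {1,...,m}, let W(ℓ) be the maximum of Σ_{i∈T} x_i over all subsets T of {i : d_i ≤ ℓ} with |T| ≤ ⌊m/ℓ⌋ (the welfare obtained by the ascending auction that sells bundles of size ℓ to the at most ⌊m/ℓ⌋ highest-value bidders satiated by ℓ items). Then Σ_{j=0}^{⌈log₂ m⌉} W(min(2^j, m)) ≥ OPT/3. In particular, the Random-Bundles mechanism, which picks j uniformly at random from {0,...,⌈log₂ m⌉} and obtains welfare W(min(2^j, m)), has expected welfare at least OPT/(3(⌈log₂ m⌉ + 1)), an O(log m) approximation to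 the optimal welfare. -/
/-- Optimal welfare in a multi-unit auction with `m` identical items and single-minded
bidders with demands `d` and values `x`: the supremum of the total value of satisfied
bidders over all allocations `q` with `∑ i, q i ≤ m`. -/
noncomputable def smOPT (m : ℕ) {n : ℕ} (d : Fin n → ℕ) (x : Fin n → ℝ) : ℝ :=
  sSup {w : ℝ | ∃ q : Fin n → ℕ, (∑ i, q i) ≤ m ∧
    w = ∑ i ∈ Finset.univ.filter (fun i => d i ≤ q i), x i}

/-- The welfare obtained by the ascending auction that sells bundles of size `ℓ` to the at
most `⌊m/ℓ⌋` highest-value bidders satiated by `ℓ` items: the supremum of `∑ i ∈ T, x i`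
over subsets `T ⊆ {i : d i ≤ ℓ}` with `|T| ≤ ⌊m/ℓ⌋`. -/
noncomputable def bundleW (m : ℕ) {n : ℕ} (d : Fin n → ℕ) (x : Fin n → ℝ) (ℓ : ℕ) : ℝ :=
  sSup {w : ℝ | ∃ T : Finset (Fin n), (∀ i ∈ T, d i ≤ ℓ) ∧ T.card ≤ m / ℓ ∧
    w = ∑ i ∈ T, x i}

/-- A set of at most `c * k` elements splits into `c` parts of size at most `k`, so a bound `W` on
the weight of each small part bounds the total weight by `c * W`. -/
theorem Finset.sum_le_mul_of_card_le_mul {ι : Type*} (x : ι → ℝ) (k : ℕ) (W : ℝ) (c : ℕ)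
    (S : Finset ι) (hW : ∀ T ⊆ S, T.card ≤ k → ∑ i ∈ T, x i ≤ W) (hS : S.card ≤ c * k) :
    ∑ i ∈ S, x i ≤ c * W := by
  classical
  induction c generalizing S with
  | zero =>
    have : S = ∅ := by simpa using hS
    simp [this]
  | succ c ih =>
    obtain ⟨T, hTS, hT⟩ := Finset.exists_subset_card_eq (min_le_right k S.card)
    have hcard := Finset.card_sdiff_add_card_eq_card hTS
    have hrest := ih (S \ T) (fun U hU => hW U (hU.trans Finset.sdiff_subset)) (by
      rw [add_mul, one_mul] at hS
      omega)
    have hpart := hW T hTS (by omega)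
    rw [← Finset.sum_sdiff hTS]
    push_cast
    linarith

theorem sum_le_bundleW {m n : ℕ} {d : Fin n → ℕ} {x : Fin n → ℝ} (hx : ∀ i, 0 ≤ x i) {ℓ : ℕ}
    {T : Finset (Fin n)} (hT : ∀ i ∈ T, d i ≤ ℓ) (hcard : T.card ≤ m / ℓ) :
    ∑ i ∈ T, x i ≤ bundleW m d x ℓ := by
  refine le_csSup ⟨∑ i, x i, ?_⟩ ⟨T, hT, hcard, rfl⟩
  rintro w ⟨U, -, -, rfl⟩
  exact Finset.sum_le_sum_of_subset_of_nonneg (Finset.subset_univ U) fun i _ _ => hx i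

theorem Nat.two_pow_clog_lt_two_mul {a : ℕ} (ha : 1 ≤ a) : 2 ^ Nat.clog 2 a < 2 * a := by
  rcases ha.eq_or_lt with rfl | h
  · simp
  · have hlt := Nat.pow_pred_clog_lt_self one_lt_two h
    have hpos := Nat.clog_pos one_lt_two h
    obtain ⟨k, hk⟩ := Nat.exists_eq_succ_of_ne_zero hpos.ne'
    rw [hk, Nat.pred_succ] at hlt
    rw [hk, pow_succ]
    omega

/-- A feasible set of bidders whose demands lie within a factor two below `ℓ` has value at most
three times the welfare of selling bundles of size `ℓ`. -/
theorem sum_le_three_mul_bundleW {m n : ℕ} {d : Fin n → ℕ} {x : Fin n → ℝ} (hx : ∀ i, 0 ≤ x i)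
    {ℓ : ℕ} (hℓ : 1 ≤ ℓ) (hℓm : ℓ ≤ m) {S : Finset (Fin n)} (hS : ∀ i ∈ S, d i ≤ ℓ)
    (hS' : ∀ i ∈ S, ℓ ≤ 2 * d i) (hsum : ∑ i ∈ S, d i ≤ m) :
    ∑ i ∈ S, x i ≤ 3 * bundleW m d x ℓ := by
  have hk : 1 ≤ m / ℓ := Nat.div_pos hℓm hℓ
  have hcard : S.card * ℓ ≤ 2 * m := by
    calc S.card * ℓ = ∑ _i ∈ S, ℓ := by simp
      _ ≤ ∑ i ∈ S, 2 * d i := Finset.sum_le_sum hS'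
      _ = 2 * ∑ i ∈ S, d i := by rw [Finset.mul_sum]
      _ ≤ 2 * m := by omega
  have hlt : m < (m / ℓ + 1) * ℓ := Nat.lt_mul_of_div_lt (Nat.lt_succ_self _) hℓ
  have hlt' : S.card < 2 * (m / ℓ + 1) := by
    refine lt_of_mul_lt_mul_right (a := ℓ) ?_ (Nat.zero_le _)
    rw [mul_assoc]
    omega
  have h := Finset.sum_le_mul_of_card_le_mul x (m / ℓ) (bundleW m d x ℓ) 3 S
    (fun T hT hc => sum_le_bundleW hx (fun i hi => hS i (hT hi)) hc) (by omega)
  exact_mod_cast h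

theorem smOPT_le_three_mul_sum_bundleW {m n : ℕ} (hm : 1 ≤ m) {d : Fin n → ℕ}
    (hd : ∀ i, 1 ≤ d i ∧ d i ≤ m) {x : Fin n → ℝ} (hx : ∀ i, 0 ≤ x i) :
    smOPT m d x ≤
      3 * ∑ j ∈ Finset.range (Nat.clog 2 m + 1), bundleW m d x (min (2 ^ j) m) := by
  refine csSup_le ⟨_, fun _ => 0, by simp, rfl⟩ ?_
  rintro w ⟨q, hq, rfl⟩
  set S := Finset.univ.filter fun i => d i ≤ q i
  have hSm : ∑ i ∈ S, d i ≤ m :=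
    calc ∑ i ∈ S, d i ≤ ∑ i ∈ S, q i := Finset.sum_le_sum fun i hi => (Finset.mem_filter.1 hi).2
      _ ≤ ∑ i, q i := Finset.sum_le_sum_of_subset (Finset.subset_univ S)
      _ ≤ m := hq
  rw [← Finset.sum_fiberwise_of_maps_to (s := S) (g := fun i => Nat.clog 2 (d i))
    (t := Finset.range (Nat.clog 2 m + 1))
    (fun i _ => Finset.mem_range_succ_iff.2 (Nat.clog_mono_right 2 (hd i).2)), Finset.mul_sum]
  refine Finset.sum_le_sum fun j _ => ?_
  refine sum_le_three_mul_bundleW hx (le_min Nat.one_le_two_pow hm) (min_le_right _ _) ?_ ?_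
    ((Finset.sum_le_sum_of_subset (Finset.filter_subset _ _)).trans hSm)
  · intro i hi
    rw [← (Finset.mem_filter.1 hi).2]
    exact le_min (Nat.le_pow_clog one_lt_two _) (hd i).2
  · intro i hi
    rw [← (Finset.mem_filter.1 hi).2]
    exact (min_le_left _ _).trans (Nat.two_pow_clog_lt_two_mul (hd i).1).le

/-- The Random-Bundles mechanism: the welfares obtained for the bundle sizes
`min (2^j) m`, `j = 0, …, ⌈log₂ m⌉`, sum to at least `OPT/3`; in particular, picking `j`
uniformly at random gives expected welfare at least `OPT / (3(⌈log₂ m⌉ + 1))`, an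
`O(log m)` approximation. -/
theorem random_bundles_log_approx (m n : ℕ) (hm : 1 ≤ m)
    (d : Fin n → ℕ) (hd : ∀ i, 1 ≤ d i ∧ d i ≤ m)
    (x : Fin n → ℝ) (hx : ∀ i, 0 ≤ x i) :
    smOPT m d x / 3 ≤
      (∑ j ∈ Finset.range (Nat.clog 2 m + 1), bundleW m d x (min (2 ^ j) m)) ∧
    smOPT m d x / (3 * (Nat.clog 2 m + 1)) ≤
      (∑ j ∈ Finset.range (Nat.clog 2 m + 1), bundleW m d x (min (2 ^ j) m)) /
        (Nat.clog 2 m + 1) := by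
  have h := smOPT_le_three_mul_sum_bundleW hm hd hx
  refine ⟨by linarith, ?_⟩
  rw [← div_div]
  gcongr
  linarith
end

section
/- Let x : N → ℝ be a nonnegative function on a type of bidders, and let A and B be finite subsets of N such that |B| ≤ 2·|A| and such that every bidder in B \ A has value at most that of every bidder in A (i.e., x_i ≤ x_j for all i ∈ B \ A and j ∈ A). Then Σ_{i∈B} x_i ≤ 3 · Σ_{j∈A} x_j. -/
/-- If `|B| ≤ 2|A|` and every bidder in `B \ A` has value at most that of every bidder in
`A`, then the total value of `B` is at most three times the total value of `A`. -/
theorem sum_le_three_mul_sum {N : Type*} [DecidableEq N]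
    (x : N → ℝ) (hx : ∀ i, 0 ≤ x i) (A B : Finset N)
    (hcard : B.card ≤ 2 * A.card)
    (hle : ∀ i ∈ B \ A, ∀ j ∈ A, x i ≤ x j) :
    ∑ i ∈ B, x i ≤ 3 * ∑ j ∈ A, x j := by
  rcases A.eq_empty_or_nonempty with rfl | hA
  · have hB : B = ∅ := by simpa using hcard
    simp [hB]
  obtain ⟨m, hm, hmin⟩ := A.exists_min_image x hA
  have hdiff : ∑ i ∈ B \ A, x i ≤ ((B \ A).card : ℝ) * x m := by
    simpa using Finset.sum_le_card_nsmul (B \ A) x (x m) fun i hi => hle i hi m hm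
  have hsum : (A.card : ℝ) * x m ≤ ∑ j ∈ A, x j := by
    simpa using Finset.card_nsmul_le_sum A x (x m) hmin
  have hcard' : ((B \ A).card : ℝ) ≤ 2 * A.card := by
    exact_mod_cast (Finset.card_le_card Finset.sdiff_subset).trans hcard
  have hinter : ∑ i ∈ B ∩ A, x i ≤ ∑ j ∈ A, x j :=
    Finset.sum_le_sum_of_subset_of_nonneg Finset.inter_subset_right fun i _ _ => hx i
  have hsplit := Finset.sum_inter_add_sum_sdiff B A x
  have hmul := mul_le_mul_of_nonneg_right hcard' (hx m)
  linarith
end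

section
/- Consider a combinatorial auction with a finite set M of items and n additive bidders indexed 1,...,n, where bidder i has value v_{ij} ≥ 0 for item j and value Σ_{j∈A} v_{ij} for a bundle A. Draw independent fair coins σ : {1,...,n} → Bool and let S = {i : σ(i) = true} be the sampled bidders and U its complement. For each item j, let p_j = max_{i∈S} v_{ij} (with p_j = 0 if S is empty) and, when S is nonempty, let n(j) be the smallest index attaining this maximum in S. Allocate each item j to the smallest-index bidder i ∈ U (if any) such that v_{ij} > p_j, or v_{ij} = p_j and S is nonempty and i < n(j); the welfare is the sum over items of the allocated bidder's value (0 for unallocated items). Then the expected welfare of this allocation over σ is at least (1/4)·Σ_{j∈M} max_{1≤i≤n} v_{ij}, i.e., at least one quarter of the optimal welfare; hence the mechanism is a 4-approximation for additive bidders. -/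
open scoped Classical

/-- The threshold price of item `j`: the maximum value of a sampled bidder
(`S = {i : σ i = true}`) for item `j`, and `0` if no bidder is sampled
(`sSup ∅ = 0` over `ℝ`). -/
noncomputable def itemPrice {M : Type*} {n : ℕ} (v : Fin n → M → ℝ)
    (σ : Fin n → Bool) (j : M) : ℝ :=
  sSup {w : ℝ | ∃ i, σ i = true ∧ w = v i j}

/-- The set of unsampled bidders eligible to buy item `j`: those `i ∉ S` with either
`v i j > p j`, or `v i j = p j`, `S` nonempty, and `i` smaller than every sampled bidder
attaining the maximum (i.e. `i < n(j)`). -/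
noncomputable def eligible {M : Type*} {n : ℕ} (v : Fin n → M → ℝ)
    (σ : Fin n → Bool) (j : M) : Finset (Fin n) :=
  Finset.univ.filter fun i => σ i = false ∧
    (itemPrice v σ j < v i j ∨
      (v i j = itemPrice v σ j ∧ (∃ i', σ i' = true) ∧
        ∀ i', σ i' = true → v i' j = itemPrice v σ j → i < i'))

/-- The welfare of Mechanism "Additive" for coins `σ`: each item `j` is bought by the
smallest-index eligible unsampled bidder (contributing her value), if any. -/
noncomputable def addWelfare {M : Type*} [Fintype M] {n : ℕ} (v : Fin n → M → ℝ)
    (σ : Fin n → Bool) : ℝ :=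
  ∑ j, if h : (eligible v σ j).Nonempty then v ((eligible v σ j).min' h) j else 0

/-- Among the bidders in a nonempty finite set there is a first one in the order by decreasing
value, ties being broken towards the smaller index. -/
theorem exists_first_by_value {ι : Type*} [LinearOrder ι] (w : ι → ℝ) {s : Finset ι}
    (hs : s.Nonempty) :
    ∃ a ∈ s, ∀ i ∈ s, i ≠ a → w i < w a ∨ (w i = w a ∧ a < i) := by
  obtain ⟨a, ha, hmin⟩ := s.exists_min_image (fun i => toLex (-w i, i)) hs
  refine ⟨a, ha, fun i hi hia => ?_⟩
  rcases (Prod.Lex.le_iff.mp (hmin i hi)) with h | ⟨h, h'⟩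
  · exact Or.inl (neg_lt_neg_iff.mp h)
  · exact Or.inr ⟨(neg_injective h).symm, lt_of_le_of_ne h' hia.symm⟩

/-- Prescribing the coins on `T` costs a factor of at most `2 ^ #T` in the number of outcomes. -/
theorem card_coins_le {ι : Type*} [Fintype ι] [DecidableEq ι] (T : Finset ι) (τ : ι → Bool) :
    Fintype.card (ι → Bool) ≤
      (Finset.univ.filter fun σ : ι → Bool => ∀ i ∈ T, σ i = τ i).card * 2 ^ T.card := by
  have hcard : (Finset.univ : Finset (T → Bool)).card = 2 ^ T.card := by simp
  rw [← hcard, ← Finset.card_product, ← Finset.card_univ]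
  refine Finset.card_le_card_of_injOn
    (fun σ => (fun i => if i ∈ T then τ i else σ i, fun i => σ i)) ?_ ?_
  · intro σ _
    simp +contextual
  · intro σ _ σ' _ h
    obtain ⟨h₁, h₂⟩ := Prod.mk.inj h
    funext i
    by_cases hi : i ∈ T
    · exact congrFun h₂ ⟨i, hi⟩
    · simpa [hi] using congrFun h₁ i

/-- A nonnegative function of the coins which is at least `c` whenever at most two prescribed
coins fall as prescribed has expectation at least `c / 4`. -/
theorem quarter_le_sum_coins {ι : Type*} [Fintype ι] [DecidableEq ι] {T : Finset ι}
    (hT : T.card ≤ 2) (τ : ι → Bool) {f : (ι → Bool) → ℝ} (hf : ∀ σ, 0 ≤ f σ) {c : ℝ} (hc : 0 ≤ c)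
    (h : ∀ σ, (∀ i ∈ T, σ i = τ i) → c ≤ f σ) :
    1 / 4 * c * Fintype.card (ι → Bool) ≤ ∑ σ, f σ := by
  set F := Finset.univ.filter fun σ : ι → Bool => ∀ i ∈ T, σ i = τ i with hF
  have hle : Fintype.card (ι → Bool) ≤ F.card * 4 :=
    (card_coins_le T τ).trans
      (Nat.mul_le_mul_left _ (Nat.pow_le_pow_right (by norm_num) hT))
  have hle' : (Fintype.card (ι → Bool) : ℝ) ≤ F.card * 4 := by exact_mod_cast hle
  calc 1 / 4 * c * Fintype.card (ι → Bool) ≤ 1 / 4 * c * (F.card * 4) := by gcongr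
    _ = ∑ _σ ∈ F, c := by rw [Finset.sum_const, nsmul_eq_mul]; ring
    _ ≤ ∑ σ ∈ F, f σ := Finset.sum_le_sum fun σ hσ => h σ (Finset.mem_filter.mp hσ).2
    _ ≤ ∑ σ, f σ :=
      Finset.sum_le_sum_of_subset_of_nonneg (Finset.subset_univ _) fun σ _ _ => hf σ

/-- The contribution of item `j` to the welfare. -/
noncomputable def itemWelfare {M : Type*} {n : ℕ} (v : Fin n → M → ℝ)
    (σ : Fin n → Bool) (j : M) : ℝ :=
  if h : (eligible v σ j).Nonempty then v ((eligible v σ j).min' h) j else 0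

theorem itemWelfare_nonneg {M : Type*} {n : ℕ} {v : Fin n → M → ℝ} (hv : ∀ i j, 0 ≤ v i j)
    (σ : Fin n → Bool) (j : M) : 0 ≤ itemWelfare v σ j := by
  unfold itemWelfare
  split_ifs
  · exact hv _ _
  · exact le_rfl

theorem itemWelfare_of_eligible_eq_singleton {M : Type*} {n : ℕ} {v : Fin n → M → ℝ}
    {σ : Fin n → Bool} {j : M} {a : Fin n} (h : eligible v σ j = {a}) :
    itemWelfare v σ j = v a j := by
  simp [itemWelfare, h]

/-- If the first bidder `a` is unsampled and the second bidder `b` is sampled, then `a` is the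
only eligible bidder. -/
theorem eligible_eq_singleton {M : Type*} {n : ℕ} {v : Fin n → M → ℝ} {σ : Fin n → Bool}
    {j : M} {a b : Fin n} (hab : v b j < v a j ∨ (v b j = v a j ∧ a < b))
    (hb : ∀ i, i ≠ a → i ≠ b → v i j < v b j ∨ (v i j = v b j ∧ b < i))
    (hσa : σ a = false) (hσb : σ b = true) : eligible v σ j = {a} := by
  have hrest : ∀ i, σ i = true → i = b ∨ v i j < v b j ∨ (v i j = v b j ∧ b < i) := by
    intro i hi
    by_cases hib : i = b
    · exact Or.inl hib
    · exact Or.inr (hb i (by rintro rfl; simp [hσa] at hi) hib)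
  have hp : itemPrice v σ j = v b j := by
    refine IsGreatest.csSup_eq ⟨⟨b, hσb, rfl⟩, ?_⟩
    rintro _ ⟨i, hi, rfl⟩
    rcases hrest i hi with rfl | h | h
    exacts [le_rfl, h.le, h.1.le]
  ext i
  simp only [eligible, hp, Finset.mem_filter, Finset.mem_univ, true_and, Finset.mem_singleton]
  constructor
  · rintro ⟨hi, h⟩
    by_contra hia
    have hib : i ≠ b := by rintro rfl; simp [hσb] at hi
    rcases hb i hia hib with h' | ⟨h', hlt⟩ <;> rcases h with h | ⟨h, -, hmin⟩
    · exact lt_asymm h h'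
    · exact h'.ne h
    · exact h.ne' h'
    · exact lt_asymm hlt (hmin b hσb rfl)
  · rintro rfl
    refine ⟨hσa, hab.imp id fun h => ⟨h.1.symm, ⟨b, hσb⟩, fun i hi hvi => ?_⟩⟩
    rcases hrest i hi with rfl | h' | h'
    exacts [h.2, absurd hvi h'.ne, h.2.trans h'.2]

/-- A sole bidder who is unsampled contributes her value. -/
theorem le_itemWelfare_of_sole {M : Type*} {n : ℕ} {v : Fin n → M → ℝ}
    (hv : ∀ i j, 0 ≤ v i j) {σ : Fin n → Bool} {j : M} {a : Fin n} (ha : ∀ i, i = a)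
    (hσa : σ a = false) : v a j ≤ itemWelfare v σ j := by
  have hp : itemPrice v σ j = 0 := by
    have hempty : {w : ℝ | ∃ i, σ i = true ∧ w = v i j} = ∅ := by
      ext w
      simp only [Set.mem_ofPred_eq, Set.mem_empty_iff_false, iff_false]
      rintro ⟨i, hi, -⟩
      rw [ha i, hσa] at hi
      exact Bool.false_ne_true hi
    rw [itemPrice, hempty, Real.sSup_empty]
  rcases (hv a j).eq_or_lt with h | h
  · rw [← h]
    exact itemWelfare_nonneg hv σ j
  · refine (itemWelfare_of_eligible_eq_singleton ?_).ge
    ext i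
    simp [eligible, ha i, hσa, hp, h]

/-- The expected contribution of each item is at least a quarter of its highest value. -/
theorem quarter_iSup_le_sum_itemWelfare {M : Type*} {n : ℕ} (hn : 0 < n) {v : Fin n → M → ℝ}
    (hv : ∀ i j, 0 ≤ v i j) (j : M) :
    1 / 4 * (⨆ i, v i j) * Fintype.card (Fin n → Bool) ≤ ∑ σ, itemWelfare v σ j := by
  have : Nonempty (Fin n) := ⟨⟨0, hn⟩⟩
  obtain ⟨a, -, ha⟩ := exists_first_by_value (fun i => v i j) Finset.univ_nonempty
  have hsup : ⨆ i, v i j ≤ v a j := by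
    refine ciSup_le fun i => ?_
    by_cases hia : i = a
    · rw [hia]
    · rcases ha i (Finset.mem_univ i) hia with h | h
      exacts [h.le, h.1.le]
  have hquarter : 1 / 4 * v a j * Fintype.card (Fin n → Bool) ≤ ∑ σ, itemWelfare v σ j := by
    rcases (Finset.univ.erase a).eq_empty_or_nonempty with hs | hs
    · have hsole : ∀ i, i = a := fun i => by
        by_contra hia
        exact Finset.notMem_empty i (hs ▸ Finset.mem_erase.mpr ⟨hia, Finset.mem_univ i⟩)
      exact quarter_le_sum_coins (T := {a}) (by simp) (fun _ => false)
        (fun σ => itemWelfare_nonneg hv σ j) (hv a j)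
        fun σ hσ => le_itemWelfare_of_sole hv hsole (hσ a (by simp))
    · obtain ⟨b, hbs, hb⟩ := exists_first_by_value (fun i => v i j) hs
      have hba : b ≠ a := (Finset.mem_erase.mp hbs).1
      refine quarter_le_sum_coins (T := {a, b}) Finset.card_le_two (fun i => decide (i = b))
        (fun σ => itemWelfare_nonneg hv σ j) (hv a j) fun σ hσ => ?_
      refine (itemWelfare_of_eligible_eq_singleton (eligible_eq_singleton
        (ha b (Finset.mem_univ b) hba) (fun i hia hib => hb i (by simp [hia]) hib) ?_ ?_)).ge
      · simpa [hba.symm] using hσ a (by simp)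
      · simpa using hσ b (by simp)
  refine le_trans ?_ hquarter
  gcongr

/-- Mechanism "Additive" is a `4`-approximation for additive bidders: its expected welfare
over the uniformly random coins `σ` is at least one quarter of the optimal welfare
`∑ j, max_i v i j`. -/
theorem additive_4_approx {M : Type*} [Fintype M] (n : ℕ) (hn : 0 < n)
    (v : Fin n → M → ℝ) (hv : ∀ i j, 0 ≤ v i j) :
    (1 / 4) * (∑ j, ⨆ i, v i j) ≤
      (∑ σ : Fin n → Bool, addWelfare v σ) / (Fintype.card (Fin n → Bool)) := by
  rw [le_div_iff₀ (by exact_mod_cast Fintype.card_pos)]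
  calc (1 / 4) * (∑ j, ⨆ i, v i j) * (Fintype.card (Fin n → Bool) : ℝ)
      = ∑ j, 1 / 4 * (⨆ i, v i j) * (Fintype.card (Fin n → Bool) : ℝ) := by
        rw [Finset.mul_sum, Finset.sum_mul]
    _ ≤ ∑ j, ∑ σ, itemWelfare v σ j :=
        Finset.sum_le_sum fun j _ => quarter_iSup_le_sum_itemWelfare hn hv j
    _ = ∑ σ, addWelfare v σ := Finset.sum_comm
end

section
/- Consider a multi-unit auction with 2 identical items and two single-minded bidders, bidder i having demand d_i ∈ {1,2} and value x_i ≥ 0, so that v_i(q) = x_i if q ≥ d_i and v_i(q) = 0 otherwise. Then (1/2)·max(v₁(2), v₂(2)) + (1/4)·(v₁(1) + max(v₁(2) − v₁(1), v₂(1))) + (1/4)·(v₂(1) + max(v₂(2) − v₂(1), v₁(1))) ≥ (3/4)·OPT, where OPT = max(v₁(2), v₂(2), v₁(1) + v₂(1)). (This is the expected welfare of the randomized mechanism that with probability 1/2 runs a second-price auction for the grand bundle and with probability 1/2 allocates one item to a uniformly random bidder and runs a second-price auction for the remaining item; hence this mechanism achieves a 4/3-approximation to the optimal welfare.) -/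
/-- For two single-minded bidders and two identical items, the randomized mechanism that
with probability `1/2` runs a second-price auction for the grand bundle and with
probability `1/2` gives one item to a uniformly random bidder and runs a second-price
auction for the remaining item achieves expected welfare at least `(3/4)·OPT`, i.e. a
`4/3`-approximation. -/
theorem two_items_single_minded_four_thirds (d₁ d₂ : ℕ)
    (hd₁ : 1 ≤ d₁ ∧ d₁ ≤ 2) (hd₂ : 1 ≤ d₂ ∧ d₂ ≤ 2)
    (x₁ x₂ : ℝ) (hx₁ : 0 ≤ x₁) (hx₂ : 0 ≤ x₂)
    (v₁ v₂ : ℕ → ℝ)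
    (hv₁ : ∀ q, v₁ q = if d₁ ≤ q then x₁ else 0)
    (hv₂ : ∀ q, v₂ q = if d₂ ≤ q then x₂ else 0) :
    (3 / 4) * max (max (v₁ 2) (v₂ 2)) (v₁ 1 + v₂ 1) ≤
      (1 / 2) * max (v₁ 2) (v₂ 2) +
      (1 / 4) * (v₁ 1 + max (v₁ 2 - v₁ 1) (v₂ 1)) +
      (1 / 4) * (v₂ 1 + max (v₂ 2 - v₂ 1) (v₁ 1)) := by
  have h₁ : d₁ = 1 ∨ d₁ = 2 := by omega
  have h₂ : d₂ = 1 ∨ d₂ = 2 := by omega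
  rcases h₁ with rfl | rfl <;> rcases h₂ with rfl | rfl <;> norm_num [hv₁, hv₂] <;>
    grind
end

section
/- Let v₁, v₂ be valuations over subsets of a two-element item set {a,b} that are nonnegative, normalized (v_i(∅) = 0), monotone (v_i(T) ≤ v_i(T') whenever T ⊆ T'), and subadditive (v_i(T ∪ T') ≤ v_i(T) + v_i(T') for all T, T'). Then (1/4)·(v₁({a}) + max(v₁({a,b}) − v₁({a}), v₂({b}))) + (1/4)·(v₁({b}) + max(v₁({a,b}) − v₁({b}), v₂({a}))) + (1/4)·(v₂({a}) + max(v₂({a,b}) − v₂({a}), v₁({b}))) + (1/4)·(v₂({b}) + max(v₂({a,b}) − v₂({b}), v₁({a}))) ≥ (3/4)·OPT, where OPT = max(v₁({a,b}), v₂({a,b}), v₁({a}) + v₂({b}), v₁({b}) + v₂({a})). (This is the expected welfare of the mechanism that allocates a uniformly random item to a uniformly random bidder and then runs a second-price auction for the remaining item; hence it achieves a 4/3-approximation for monotone subadditive valuations.) -/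
/-- For two monotone subadditive bidders over the two-element item set `{a, b}`
(modeled as `Fin 2` with `a = 0`, `b = 1`), the mechanism that allocates a uniformly
random item to a uniformly random bidder and runs a second-price auction for the
remaining item achieves expected welfare at least `(3/4)·OPT`, i.e. a
`4/3`-approximation. -/
theorem two_items_subadditive_four_thirds
    (v₁ v₂ : Finset (Fin 2) → ℝ)
    (hnn₁ : ∀ T, 0 ≤ v₁ T) (hnn₂ : ∀ T, 0 ≤ v₂ T)
    (h0₁ : v₁ ∅ = 0) (h0₂ : v₂ ∅ = 0)
    (hmono₁ : ∀ T T', T ⊆ T' → v₁ T ≤ v₁ T')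
    (hmono₂ : ∀ T T', T ⊆ T' → v₂ T ≤ v₂ T')
    (hsub₁ : ∀ T T', v₁ (T ∪ T') ≤ v₁ T + v₁ T')
    (hsub₂ : ∀ T T', v₂ (T ∪ T') ≤ v₂ T + v₂ T') :
    (3 / 4) * max (max (v₁ {0, 1}) (v₂ {0, 1}))
        (max (v₁ {0} + v₂ {1}) (v₁ {1} + v₂ {0})) ≤
      (1 / 4) * (v₁ {0} + max (v₁ {0, 1} - v₁ {0}) (v₂ {1})) +
      (1 / 4) * (v₁ {1} + max (v₁ {0, 1} - v₁ {1}) (v₂ {0})) +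
      (1 / 4) * (v₂ {0} + max (v₂ {0, 1} - v₂ {0}) (v₁ {1})) +
      (1 / 4) * (v₂ {1} + max (v₂ {0, 1} - v₂ {1}) (v₁ {0})) := by
  have hs₁ : v₁ {0, 1} ≤ v₁ {0} + v₁ {1} := hsub₁ {0} {1}
  have hs₂ : v₂ {0, 1} ≤ v₂ {0} + v₂ {1} := hsub₂ {0} {1}
  have ha₁ : v₁ {0} ≤ v₁ {0, 1} := hmono₁ _ _ (by decide)
  have hb₁ : v₁ {1} ≤ v₁ {0, 1} := hmono₁ _ _ (by decide)
  have ha₂ : v₂ {0} ≤ v₂ {0, 1} := hmono₂ _ _ (by decide)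
  have hb₂ : v₂ {1} ≤ v₂ {0, 1} := hmono₂ _ _ (by decide)
  have l₁ := le_max_left (v₁ {0, 1} - v₁ {0}) (v₂ {1})
  have r₁ := le_max_right (v₁ {0, 1} - v₁ {0}) (v₂ {1})
  have l₂ := le_max_left (v₁ {0, 1} - v₁ {1}) (v₂ {0})
  have r₂ := le_max_right (v₁ {0, 1} - v₁ {1}) (v₂ {0})
  have l₃ := le_max_left (v₂ {0, 1} - v₂ {0}) (v₁ {1})
  have r₃ := le_max_right (v₂ {0, 1} - v₂ {0}) (v₁ {1})
  have l₄ := le_max_left (v₂ {0, 1} - v₂ {1}) (v₁ {0})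
  have r₄ := le_max_right (v₂ {0, 1} - v₂ {1}) (v₁ {0})
  rw [mul_comm, ← le_div_iff₀ (by norm_num)]
  refine max_le (max_le ?_ ?_) (max_le ?_ ?_) <;> rw [le_div_iff₀ (by norm_num)] <;> linarith
end

section
/- Let v₁, v₂ be valuations over subsets of a two-element item set {a,b} that are nonnegative, normalized (v_i(∅) = 0), and monotone (v_i(T) ≤ v_i(T') whenever T ⊆ T'). Then (1/3)·max(v₁({a,b}), v₂({a,b})) + (1/6)·(v₁({a}) + max(v₁({a,b}) − v₁({a}), v₂({b}))) + (1/6)·(v₁({b}) + max(v₁({a,b}) − v₁({b}), v₂({a}))) + (1/6)·(v₂({a}) + max(v₂({a,b}) − v₂({a}), v₁({b}))) + (1/6)·(v₂({b}) + max(v₂({a,b}) − v₂({b}), v₁({a}))) ≥ (2/3)·OPT, where OPT = max(v₁({a,b}), v₂({a,b}), v₁({a}) + v₂({b}), v₁({b}) + v₂({a})). (This is the expected welfare of the mechanism that with probability 1/3 runs a second-price auction for the grand bundle and with probability 2/3 allocates a uniformly random item to a uniformly random bidder and runs a second-price auction for the remaining item; hence it achieves a 3/2-approximation for general monotone valuations.)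 -/
/-- For two general monotone bidders over the two-element item set `{a, b}` (modeled as
`Fin 2` with `a = 0`, `b = 1`), the mechanism that with probability `1/3` runs a
second-price auction for the grand bundle and with probability `2/3` allocates a
uniformly random item to a uniformly random bidder and runs a second-price auction for
the remaining item achieves expected welfare at least `(2/3)·OPT`, i.e. a
`3/2`-approximation. -/
theorem two_items_monotone_three_halves
    (v₁ v₂ : Finset (Fin 2) → ℝ)
    (hnn₁ : ∀ T, 0 ≤ v₁ T) (hnn₂ : ∀ T, 0 ≤ v₂ T)
    (h0₁ : v₁ ∅ = 0) (h0₂ : v₂ ∅ = 0)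
    (hmono₁ : ∀ T T', T ⊆ T' → v₁ T ≤ v₁ T')
    (hmono₂ : ∀ T T', T ⊆ T' → v₂ T ≤ v₂ T') :
    (2 / 3) * max (max (v₁ {0, 1}) (v₂ {0, 1}))
        (max (v₁ {0} + v₂ {1}) (v₁ {1} + v₂ {0})) ≤
      (1 / 3) * max (v₁ {0, 1}) (v₂ {0, 1}) +
      (1 / 6) * (v₁ {0} + max (v₁ {0, 1} - v₁ {0}) (v₂ {1})) +
      (1 / 6) * (v₁ {1} + max (v₁ {0, 1} - v₁ {1}) (v₂ {0})) +
      (1 / 6) * (v₂ {0} + max (v₂ {0, 1} - v₂ {0}) (v₁ {1})) +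
      (1 / 6) * (v₂ {1} + max (v₂ {0, 1} - v₂ {1}) (v₁ {0})) := by
  have ha₁ := hmono₁ {0} {0, 1} (by decide)
  have hb₁ := hmono₁ {1} {0, 1} (by decide)
  have ha₂ := hmono₂ {0} {0, 1} (by decide)
  have hb₂ := hmono₂ {1} {0, 1} (by decide)
  have hA := le_max_left (v₁ {0, 1}) (v₂ {0, 1})
  have hB := le_max_right (v₁ {0, 1}) (v₂ {0, 1})
  have h₁ := le_max_left (v₁ {0, 1} - v₁ {0}) (v₂ {1})
  have h₁' := le_max_right (v₁ {0, 1} - v₁ {0}) (v₂ {1})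
  have h₂ := le_max_left (v₁ {0, 1} - v₁ {1}) (v₂ {0})
  have h₂' := le_max_right (v₁ {0, 1} - v₁ {1}) (v₂ {0})
  have h₃ := le_max_left (v₂ {0, 1} - v₂ {0}) (v₁ {1})
  have h₃' := le_max_right (v₂ {0, 1} - v₂ {0}) (v₁ {1})
  have h₄ := le_max_left (v₂ {0, 1} - v₂ {1}) (v₁ {0})
  have h₄' := le_max_right (v₂ {0, 1} - v₂ {1}) (v₁ {0})
  rw [mul_max_of_nonneg _ _ (by norm_num), mul_max_of_nonneg _ _ (by norm_num),
    mul_max_of_nonneg _ _ (by norm_num)]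
  have hn₁ := hnn₁ {0, 1}
  have hn₂ := hnn₂ {0, 1}
  refine max_le (max_le ?_ ?_) (max_le ?_ ?_) <;> linarith
end

section
/- Consider a multi-unit auction with 3 identical items and two bidders whose valuations v₁, v₂ : {0,1,2,3} → ℝ are nonnegative, satisfy v_i(0) = 0, and have decreasing marginals (v_i(j+1) − v_i(j) ≤ v_i(j) − v_i(j−1) for j = 1, 2). If v₁(2) − v₁(1) ≥ v₂(2) − v₂(1), then v₁(2) + v₂(1) ≥ (2/3)·OPT, where OPT = max over nonnegative integers o₁ + o₂ = 3 of v₁(o₁) + v₂(o₂). (This shows that the deterministic mechanism that allocates one item to each bidder and runs an ascending auction for the third item—awarding it to the bidder with the larger marginal value for a second item—achieves a 1.5-approximation to the optimal welfare for two bidders with decreasing marginal valuations and three items.) -/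
/-- For two bidders with nonnegative decreasing-marginal valuations and three identical
items, allocating one item to each bidder and giving the third item to the bidder with
the larger marginal value for a second item (here bidder 1) achieves welfare at least
`(2/3)·OPT`, a `1.5`-approximation to the optimal welfare
`OPT = max(v₁ 3, v₂ 3, v₁ 2 + v₂ 1, v₁ 1 + v₂ 2)`. -/
theorem three_items_decreasing_marginals_three_halves (v₁ v₂ : ℕ → ℝ)
    (h0₁ : v₁ 0 = 0) (h0₂ : v₂ 0 = 0)
    (hnn₁ : ∀ q, q ≤ 3 → 0 ≤ v₁ q) (hnn₂ : ∀ q, q ≤ 3 → 0 ≤ v₂ q)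
    (hdec₁ : ∀ j, 1 ≤ j → j ≤ 2 → v₁ (j + 1) - v₁ j ≤ v₁ j - v₁ (j - 1))
    (hdec₂ : ∀ j, 1 ≤ j → j ≤ 2 → v₂ (j + 1) - v₂ j ≤ v₂ j - v₂ (j - 1))
    (hmarg : v₂ 2 - v₂ 1 ≤ v₁ 2 - v₁ 1) :
    (2 / 3) * max (max (v₁ 3) (v₂ 3)) (max (v₁ 2 + v₂ 1) (v₁ 1 + v₂ 2)) ≤
      v₁ 2 + v₂ 1 := by
  have hfst := hdec₁ 1 le_rfl (by norm_num)
  have hsnd := hdec₁ 2 (by norm_num) le_rfl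
  have hfst' := hdec₂ 1 le_rfl (by norm_num)
  have hsnd' := hdec₂ 2 (by norm_num) le_rfl
  have hv₁ := hnn₁ 2 (by norm_num)
  have hv₂ := hnn₂ 1 (by norm_num)
  norm_num at hfst hsnd hfst' hsnd'
  suffices h : max (max (v₁ 3) (v₂ 3)) (max (v₁ 2 + v₂ 1) (v₁ 1 + v₂ 2)) ≤
      3 / 2 * (v₁ 2 + v₂ 1) by linarith
  refine max_le (max_le ?_ ?_) (max_le ?_ ?_) <;> linarith
end
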